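/- Let n and r be positive integers with n ≥ 2r and n ≠ 2r+2, and let 𝒜 ⊆ [n]^(r)_* be an intersecting family of separated r-subsets of [n] with |𝒜| = binomial(n−r−1, r−1). Then there exists i ∈ [n] such that 𝒜 = {A ∈ [n]^(r)_* : i ∈ A}. -/

import Mathlib

/-- The family of all `k`-separated `r`-subsets of `[n] = {1,…,n}`:
`A = {a₁ < … < a_r} ⊆ [n]` with consecutive circular gaps all `> k`.
Equivalently (for nonempty `A`): `k < n` and every pair `a < b` in `A`
satisfies `b - a > k` and `(a + n) - b > k`. -/
def sepSets (n k r : ℕ) : Finset (Finset ℕ) :=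
  (Finset.Icc 1 n).powerset.filter fun A =>
    A.card = r ∧ k < n ∧ ∀ a ∈ A, ∀ b ∈ A, a < b → k < b - a ∧ b - a + k < n

/-- A family of sets is intersecting if any two members meet. -/
def Intersecting (𝒜 : Finset (Finset ℕ)) : Prop :=
  ∀ A ∈ 𝒜, ∀ B ∈ 𝒜, (A ∩ B).Nonempty

lemma mem_sep {n r : ℕ} (hn : 2 ≤ n) (A : Finset ℕ) :
    A ∈ sepSets n 1 r ↔ (∀ a ∈ A, 1 ≤ a ∧ a ≤ n) ∧ A.card = r ∧ (∀ a ∈ A, a + 1 ∉ A) ∧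
      (1 ∈ A → n ∉ A) := by
  unfold sepSets
  rw [Finset.mem_filter, Finset.mem_powerset, Finset.subset_iff]
  simp only [Finset.mem_Icc]
  constructor
  · rintro ⟨h1, h2, h3, h4⟩
    refine ⟨fun a ha => h1 ha, h2, ?_, ?_⟩
    · intro a ha hb
      have := h4 a ha _ hb (by omega)
      omega
    · intro ha hb
      have := h4 _ ha _ hb (by omega)
      omega
  · rintro ⟨h1, h2, h3, h4⟩
    refine ⟨fun a ha => h1 a ha, h2, by omega, ?_⟩
    intro a ha b hb hab
    have ha' := h1 a ha
    have hb' := h1 b hb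
    constructor
    · by_contra h
      have : b = a + 1 := by omega
      subst this
      exact h3 a ha hb
    · by_contra h
      have e1 : a = 1 := by omega
      have e2 : b = n := by omega
      subst e1 e2
      exact h4 ha hb

lemma path_bound {m : ℕ} (A : Finset ℕ) (h1 : ∀ a ∈ A, 1 ≤ a ∧ a ≤ m)
    (h2 : ∀ a ∈ A, a + 1 ∉ A) : 2 * A.card ≤ m + 1 := by
  have hd : Disjoint A (A.image (· + 1)) := by
    rw [Finset.disjoint_left]
    intro x hx hx'
    obtain ⟨y, hy, rfl⟩ := Finset.mem_image.1 hx'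
    exact h2 y hy hx
  have hc : (A.image (· + 1)).card = A.card :=
    Finset.card_image_of_injective _ (fun a b h => by simpa using h)
  have hs : A ∪ A.image (· + 1) ⊆ Finset.Icc 1 (m + 1) := by
    intro x hx
    rw [Finset.mem_Icc]
    rcases Finset.mem_union.1 hx with hx | hx
    · have := h1 x hx; omega
    · obtain ⟨y, hy, rfl⟩ := Finset.mem_image.1 hx
      have := h1 y hy; omega
  have := Finset.card_le_card hs
  rw [Finset.card_union_of_disjoint hd, hc, Nat.card_Icc] at this
  omega

lemma sep_bound {n r : ℕ} (hn : 2 ≤ n) {A : Finset ℕ} (hr : 1 ≤ r) (hA : A ∈ sepSets n 1 r) :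
    2 * r ≤ n := by
  obtain ⟨h1, h2, h3, h4⟩ := (mem_sep hn A).1 hA
  by_cases h : 1 ∈ A
  · have := path_bound (m := n - 1) A (fun a ha => by
      have := h1 a ha
      have : a ≠ n := by rintro rfl; exact h4 h ha
      omega) h3
    omega
  · have hb := path_bound (m := n - 1) (A.image (· - 1)) (fun a ha => by
      obtain ⟨b, hb, rfl⟩ := Finset.mem_image.1 ha
      have := h1 b hb
      have : b ≠ 1 := by rintro rfl; exact h hb
      omega) (fun a ha ha' => by
      obtain ⟨b, hb, rfl⟩ := Finset.mem_image.1 ha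
      obtain ⟨c, hc, hcb⟩ := Finset.mem_image.1 ha'
      have := h1 b hb
      have := h1 c hc
      have : c = b + 1 := by
        have : b ≠ 1 := by rintro rfl; exact h hb
        omega
      exact h3 b hb (this ▸ hc))
    rw [Finset.card_image_of_injOn] at hb
    · omega
    · intro a ha b hb hab
      have := h1 a ha
      have := h1 b hb
      simp only at hab
      omega

/-- contraction map -/
def fmap (x : ℕ) : ℕ := if x ≤ 1 then 1 else x - 1

def gset (A : Finset ℕ) : Finset ℕ := ((A.erase 1).erase 2).image (· - 2)

/-- the exceptional members -/
def Kfam (n : ℕ) (𝒜 : Finset (Finset ℕ)) : Finset (Finset ℕ) :=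
  𝒜.filter fun A => (1 ∈ A ∧ 3 ∈ A) ∨ (2 ∈ A ∧ n ∈ A) ∨ (1 ∈ A ∧ insert 2 (A.erase 1) ∈ 𝒜)

lemma mem_fimage {A : Finset ℕ} (h : ∀ a ∈ A, 1 ≤ a) (y : ℕ) :
    y ∈ A.image fmap ↔ (y = 1 ∧ 1 ∈ A) ∨ (1 ≤ y ∧ y + 1 ∈ A) := by
  rw [Finset.mem_image]
  constructor
  · rintro ⟨x, hx, rfl⟩
    have := h x hx
    unfold fmap
    split_ifs with h1
    · left
      have : x = 1 := by omega
      subst this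
      exact ⟨rfl, hx⟩
    · right
      refine ⟨by omega, ?_⟩
      rwa [show x - 1 + 1 = x by omega]
  · rintro (⟨rfl, h1⟩ | ⟨h1, h2⟩)
    · exact ⟨1, h1, rfl⟩
    · refine ⟨y + 1, h2, ?_⟩
      unfold fmap
      rw [if_neg (by omega)]
      omega

lemma mem_gset {A : Finset ℕ} (h : ∀ a ∈ A, 1 ≤ a) (y : ℕ) :
    y ∈ gset A ↔ 1 ≤ y ∧ y + 2 ∈ A := by
  unfold gset
  simp only [Finset.mem_image, Finset.mem_erase]
  constructor
  · rintro ⟨x, ⟨h1, h2, h3⟩, rfl⟩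
    have := h x h3
    refine ⟨by omega, ?_⟩
    rwa [show x - 2 + 2 = x by omega]
  · rintro ⟨h1, h2⟩
    exact ⟨y + 2, ⟨by omega, by omega, h2⟩, by omega⟩

lemma fimage_sep {n r : ℕ} (hn : 4 ≤ n) {A : Finset ℕ} (hA : A ∈ sepSets n 1 r)
    (h13 : ¬ (1 ∈ A ∧ 3 ∈ A)) (h2n : ¬ (2 ∈ A ∧ n ∈ A)) :
    A.image fmap ∈ sepSets (n - 1) 1 r := by
  obtain ⟨h1, h2, h3, h4⟩ := (mem_sep (by omega) A).1 hA
  have h0 : ∀ a ∈ A, 1 ≤ a := fun a ha => (h1 a ha).1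
  rw [mem_sep (by omega)]
  refine ⟨?_, ?_, ?_, ?_⟩
  · intro y hy
    rcases (mem_fimage h0 y).1 hy with ⟨rfl, _⟩ | ⟨hy1, hy2⟩
    · omega
    · have := h1 _ hy2; omega
  · rw [Finset.card_image_of_injOn, h2]
    intro a ha b hb hab
    have := h1 a ha
    have := h1 b hb
    have e1 : a = 1 → b ≠ 2 := by rintro rfl rfl; exact h3 1 ha hb
    have e2 : b = 1 → a ≠ 2 := by rintro rfl rfl; exact h3 1 hb ha
    unfold fmap at hab
    split_ifs at hab <;> omega
  · intro y hy hy'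
    rcases (mem_fimage h0 y).1 hy with ⟨rfl, hy1⟩ | ⟨hy1, hy2⟩
    · rcases (mem_fimage h0 _).1 hy' with ⟨h, _⟩ | ⟨_, hy3⟩
      · omega
      · exact h13 ⟨hy1, hy3⟩
    · rcases (mem_fimage h0 _).1 hy' with ⟨h, _⟩ | ⟨_, hy3⟩
      · omega
      · exact h3 _ hy2 hy3
  · intro hy hy'
    rcases (mem_fimage h0 _).1 hy' with ⟨h, _⟩ | ⟨_, hy3⟩
    · omega
    rw [show n - 1 + 1 = n by omega] at hy3
    rcases (mem_fimage h0 1).1 hy with ⟨_, hy1⟩ | ⟨hy1, hy2⟩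
    · exact h4 hy1 hy3
    · exact h2n ⟨hy2, hy3⟩

lemma gset_sep {n r : ℕ} (hn : 4 ≤ n) {A : Finset ℕ} (hA : A ∈ sepSets n 1 r)
    (h12 : 1 ∈ A ∨ 2 ∈ A) : gset A ∈ sepSets (n - 2) 1 (r - 1) := by
  obtain ⟨h1, h2, h3, h4⟩ := (mem_sep (by omega) A).1 hA
  have h0 : ∀ a ∈ A, 1 ≤ a := fun a ha => (h1 a ha).1
  rw [mem_sep (by omega)]
  refine ⟨?_, ?_, ?_, ?_⟩
  · intro y hy
    obtain ⟨hy1, hy2⟩ := (mem_gset h0 y).1 hy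
    have := h1 _ hy2; omega
  · unfold gset
    rw [Finset.card_image_of_injOn]
    · rcases h12 with h | h
      · rw [Finset.erase_eq_of_notMem (a := 2), Finset.card_erase_of_mem h, h2]
        intro h'
        exact h3 1 h (Finset.mem_of_mem_erase h')
      · rw [Finset.erase_eq_of_notMem (a := 1), Finset.card_erase_of_mem h, h2]
        intro h'
        exact h3 1 h' h
    · intro a ha b hb hab
      simp only [Finset.coe_erase, Set.mem_sdiff, Finset.mem_coe, Set.mem_singleton_iff] at ha hb
      have := h1 a ha.1.1
      have := h1 b hb.1.1
      simp only at hab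
      omega
  · intro y hy hy'
    obtain ⟨hy1, hy2⟩ := (mem_gset h0 y).1 hy
    obtain ⟨hy3, hy4⟩ := (mem_gset h0 _).1 hy'
    exact h3 _ hy2 (by rwa [show y + 1 + 2 = y + 2 + 1 by omega] at hy4)
  · intro hy hy'
    obtain ⟨hy1, hy2⟩ := (mem_gset h0 _).1 hy
    obtain ⟨hy3, hy4⟩ := (mem_gset h0 _).1 hy'
    rw [show n - 2 + 2 = n by omega] at hy4
    rcases h12 with h | h
    · exact h4 h hy4
    · exact h3 2 h hy2

lemma K_inj {n r : ℕ} (hn : 4 ≤ n) {A A' : Finset ℕ} (hA : A ∈ sepSets n 1 r)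
    (hA' : A' ∈ sepSets n 1 r) (h12 : (1 ∈ A ∧ 1 ∈ A') ∨ (2 ∈ A ∧ 2 ∈ A'))
    (h : gset A = gset A') : A = A' := by
  obtain ⟨h1, h2, h3, h4⟩ := (mem_sep (by omega) A).1 hA
  have h0 : ∀ a ∈ A, 1 ≤ a := fun a ha => (h1 a ha).1
  obtain ⟨h1', h2', h3', h4'⟩ := (mem_sep (by omega) A').1 hA'
  have h0' : ∀ a ∈ A', 1 ≤ a := fun a ha => (h1' a ha).1
  have key : ∀ x, 3 ≤ x → (x ∈ A ↔ x ∈ A') := by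
    intro x hx
    have e1 := mem_gset h0 (x - 2)
    have e2 := mem_gset h0' (x - 2)
    rw [show x - 2 + 2 = x by omega] at e1 e2
    rw [h, e2] at e1
    have : 1 ≤ x - 2 := by omega
    grind
  ext x
  by_cases hx : 3 ≤ x
  · exact key x hx
  · have c1 := h3 1
    have c2 := h3' 1
    have c3 := h0 0
    have c4 := h0' 0
    simp only [Nat.reduceAdd, Nat.reduceLeDiff, imp_false] at c1 c2 c3 c4
    interval_cases x <;> grind

lemma K_mem12 {n : ℕ} {𝒜 : Finset (Finset ℕ)} {A : Finset ℕ} (h : A ∈ Kfam n 𝒜) :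
    1 ∈ A ∨ 2 ∈ A := by
  unfold Kfam at h
  rw [Finset.mem_filter] at h
  tauto

lemma K_injOn {n r : ℕ} (hn : 4 ≤ n) {𝒜 : Finset (Finset ℕ)} (h𝒜 : 𝒜 ⊆ sepSets n 1 r) :
    Set.InjOn gset (Kfam n 𝒜 : Set (Finset ℕ)) := by
  have key : ∀ A ∈ Kfam n 𝒜, ∀ A' ∈ Kfam n 𝒜, 1 ∈ A → 2 ∈ A' → gset A = gset A' → False := by
    intro A hA A' hA' m1 m2 h
    unfold Kfam at hA hA'
    rw [Finset.mem_filter] at hA hA'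
    obtain ⟨h1, h2, h3, h4⟩ := (mem_sep (by omega) A).1 (h𝒜 hA.1)
    have h0 : ∀ a ∈ A, 1 ≤ a := fun a ha => (h1 a ha).1
    obtain ⟨h1', h2', h3', h4'⟩ := (mem_sep (by omega) A').1 (h𝒜 hA'.1)
    have h0' : ∀ a ∈ A', 1 ≤ a := fun a ha => (h1' a ha).1
    have c := h3' 1
    have e : n ∈ A' := by grind
    have : n - 2 ∈ gset A := by
      rw [h, mem_gset h0', show n - 2 + 2 = n by omega]
      exact ⟨by omega, e⟩
    rw [mem_gset h0, show n - 2 + 2 = n by omega] at this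
    exact h4 m1 this.2
  intro A hA A' hA' h
  rw [Finset.mem_coe] at hA hA'
  have s1 := h𝒜 (Finset.mem_of_mem_filter _ hA)
  have s2 := h𝒜 (Finset.mem_of_mem_filter _ hA')
  rcases K_mem12 hA with m | m <;> rcases K_mem12 hA' with m' | m'
  · exact K_inj hn s1 s2 (Or.inl ⟨m, m'⟩) h
  · exact (key A hA A' hA' m m' h).elim
  · exact (key A' hA' A hA m' m h.symm).elim
  · exact K_inj hn s1 s2 (Or.inr ⟨m, m'⟩) h

lemma K_int {n r : ℕ} (hn : 4 ≤ n) {𝒜 : Finset (Finset ℕ)} (h𝒜 : 𝒜 ⊆ sepSets n 1 r)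
    (hint : Intersecting 𝒜) : Intersecting ((Kfam n 𝒜).image gset) := by
  intro X hX Y hY
  obtain ⟨A, hA, rfl⟩ := Finset.mem_image.1 hX
  obtain ⟨A', hA', rfl⟩ := Finset.mem_image.1 hY
  unfold Kfam at hA hA'
  rw [Finset.mem_filter] at hA hA'
  obtain ⟨h1, h2, h3, h4⟩ := (mem_sep (by omega) A).1 (h𝒜 hA.1)
  have h0 : ∀ a ∈ A, 1 ≤ a := fun a ha => (h1 a ha).1
  obtain ⟨h1', h2', h3', h4'⟩ := (mem_sep (by omega) A').1 (h𝒜 hA'.1)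
  have h0' : ∀ a ∈ A', 1 ≤ a := fun a ha => (h1' a ha).1
  suffices h : ∃ x, 3 ≤ x ∧ x ∈ A ∧ x ∈ A' by
    obtain ⟨x, hx, hx1, hx2⟩ := h
    refine ⟨x - 2, ?_⟩
    rw [Finset.mem_inter, mem_gset h0, mem_gset h0', show x - 2 + 2 = x by omega]
    exact ⟨⟨by omega, hx1⟩, ⟨by omega, hx2⟩⟩
  have c := h3 1
  have c' := h3' 1
  have g : ∀ x, x ∈ A → x ∈ A' → x ≠ 1 → x ≠ 2 → ∃ x, 3 ≤ x ∧ x ∈ A ∧ x ∈ A' := by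
    intro x hx hx' n1 n2
    have := h0 x hx
    exact ⟨x, by omega, hx, hx'⟩
  have mixed : (1 ∈ A ∧ 2 ∈ A') ∨ (2 ∈ A ∧ 1 ∈ A') → ∃ x, 3 ≤ x ∧ x ∈ A ∧ x ∈ A' := by
    intro hm
    obtain ⟨x, hx⟩ := hint A hA.1 A' hA'.1
    rw [Finset.mem_inter] at hx
    refine g x hx.1 hx.2 ?_ ?_ <;> rintro rfl <;> simp only [Nat.reduceAdd] at c c' <;> grind
  by_cases m1 : 1 ∈ A
  · by_cases m2 : 1 ∈ A'
    · by_cases h33 : 3 ∈ A ∧ 3 ∈ A'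
      · exact ⟨3, le_refl _, h33.1, h33.2⟩
      have : insert 2 (A.erase 1) ∈ 𝒜 ∨ insert 2 (A'.erase 1) ∈ 𝒜 := by
        simp only [Nat.reduceAdd] at c c'
        grind
      rcases this with hh | hh
      · obtain ⟨x, hx⟩ := hint _ hh A' hA'.1
        simp only [Finset.mem_inter, Finset.mem_insert, Finset.mem_erase] at hx
        have n2 : x ≠ 2 := by rintro rfl; exact c' m2 hx.2
        exact g x (by grind) hx.2 (by grind) n2
      · obtain ⟨x, hx⟩ := hint _ hh A hA.1
        simp only [Finset.mem_inter, Finset.mem_insert, Finset.mem_erase] at hx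
        have n2 : x ≠ 2 := by rintro rfl; exact c m1 hx.2
        exact g x hx.2 (by grind) (by grind) n2
    · exact mixed (by grind)
  · by_cases m2 : 1 ∈ A'
    · exact mixed (by grind)
    · exact ⟨n, by omega, by grind, by grind⟩

lemma L_inj {n r : ℕ} (hn : 4 ≤ n) {𝒜 : Finset (Finset ℕ)} (h𝒜 : 𝒜 ⊆ sepSets n 1 r) :
    Set.InjOn (fun A : Finset ℕ => A.image fmap) ((𝒜 \ Kfam n 𝒜 : Finset (Finset ℕ)) : Set (Finset ℕ)) := by
  have key : ∀ A ∈ 𝒜 \ Kfam n 𝒜, ∀ A' ∈ 𝒜 \ Kfam n 𝒜, A.image fmap = A'.image fmap →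
      1 ∈ A → 1 ∈ A' := by
    intro A hA A' hA' h m1
    rw [Finset.mem_sdiff] at hA hA'
    obtain ⟨h1, h2, h3, h4⟩ := (mem_sep (by omega) A).1 (h𝒜 hA.1)
    have h0 : ∀ a ∈ A, 1 ≤ a := fun a ha => (h1 a ha).1
    obtain ⟨h1', h2', h3', h4'⟩ := (mem_sep (by omega) A').1 (h𝒜 hA'.1)
    have h0' : ∀ a ∈ A', 1 ≤ a := fun a ha => (h1' a ha).1
    by_contra m1'
    have key : ∀ x, 1 ≤ x → ((x = 1 ∧ 1 ∈ A) ∨ x + 1 ∈ A ↔ (x = 1 ∧ 1 ∈ A') ∨ x + 1 ∈ A') := by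
      intro x hx
      have e1 := mem_fimage h0 x
      have e2 := mem_fimage h0' x
      rw [h, e2] at e1
      grind
    have m2' : 2 ∈ A' := by
      have := key 1 (le_refl _)
      simp only [Nat.reduceAdd] at this
      grind
    apply hA.2
    unfold Kfam
    rw [Finset.mem_filter]
    refine ⟨hA.1, Or.inr (Or.inr ⟨m1, ?_⟩)⟩
    convert hA'.1 using 1
    ext x
    simp only [Finset.mem_insert, Finset.mem_erase]
    by_cases x2 : x = 2
    · subst x2; grind
    by_cases x1 : x = 1
    · subst x1; grind
    by_cases x0 : x = 0
    · subst x0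
      have := h0 0
      have := h0' 0
      simp only [Nat.reduceLeDiff, imp_false] at *
      grind
    have := key (x - 1) (by omega)
    rw [show x - 1 + 1 = x by omega] at this
    have : x - 1 ≠ 1 := by omega
    grind
  intro A hA A' hA' h
  simp only at h
  rw [Finset.mem_coe] at hA hA'
  have k1 := key A hA A' hA' h
  have k2 := key A' hA' A hA h.symm
  rw [Finset.mem_sdiff] at hA hA'
  obtain ⟨h1, h2, h3, h4⟩ := (mem_sep (by omega) A).1 (h𝒜 hA.1)
  have h0 : ∀ a ∈ A, 1 ≤ a := fun a ha => (h1 a ha).1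
  obtain ⟨h1', h2', h3', h4'⟩ := (mem_sep (by omega) A').1 (h𝒜 hA'.1)
  have h0' : ∀ a ∈ A', 1 ≤ a := fun a ha => (h1' a ha).1
  have c := h3 1
  have c' := h3' 1
  have key : ∀ x, 1 ≤ x → ((x = 1 ∧ 1 ∈ A) ∨ x + 1 ∈ A ↔ (x = 1 ∧ 1 ∈ A') ∨ x + 1 ∈ A') := by
    intro x hx
    have e1 := mem_fimage h0 x
    have e2 := mem_fimage h0' x
    rw [h, e2] at e1
    grind
  ext x
  by_cases x1 : x = 1
  · subst x1; grind
  by_cases x0 : x = 0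
  · subst x0
    have := h0 0
    have := h0' 0
    simp only [Nat.reduceLeDiff, imp_false] at *
    grind
  have := key (x - 1) (by omega)
  rw [show x - 1 + 1 = x by omega] at this
  by_cases x2 : x = 2
  · subst x2
    simp only [Nat.reduceAdd, Nat.reduceSub] at *
    grind
  have : x - 1 ≠ 1 := by omega
  grind

lemma f_int {𝒜 : Finset (Finset ℕ)} (hint : Intersecting 𝒜) :
    Intersecting (𝒜.image (fun A : Finset ℕ => A.image fmap)) := by
  intro X hX Y hY
  obtain ⟨A, hA, rfl⟩ := Finset.mem_image.1 hX
  obtain ⟨A', hA', rfl⟩ := Finset.mem_image.1 hY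
  obtain ⟨x, hx⟩ := hint A hA A' hA'
  rw [Finset.mem_inter] at hx
  exact ⟨fmap x, Finset.mem_inter.2 ⟨Finset.mem_image_of_mem _ hx.1, Finset.mem_image_of_mem _ hx.2⟩⟩

lemma card_le_one_of_r1 {n : ℕ} (hn : 2 ≤ n) {𝒜 : Finset (Finset ℕ)} (h𝒜 : 𝒜 ⊆ sepSets n 1 1)
    (hint : Intersecting 𝒜) : 𝒜.card ≤ 1 := by
  rw [Finset.card_le_one]
  intro A hA B hB
  have h1 := ((mem_sep hn A).1 (h𝒜 hA)).2.1
  have h2 := ((mem_sep hn B).1 (h𝒜 hB)).2.1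
  obtain ⟨a, rfl⟩ := Finset.card_eq_one.1 h1
  obtain ⟨b, rfl⟩ := Finset.card_eq_one.1 h2
  obtain ⟨x, hx⟩ := hint _ hA _ hB
  simp only [Finset.mem_inter, Finset.mem_singleton] at hx
  rw [← hx.1, ← hx.2]

lemma L_sub {n r : ℕ} (hn : 4 ≤ n) {𝒜 : Finset (Finset ℕ)} (h𝒜 : 𝒜 ⊆ sepSets n 1 r) :
    (𝒜 \ Kfam n 𝒜).image (fun A : Finset ℕ => A.image fmap) ⊆ sepSets (n - 1) 1 r := by
  intro X hX
  obtain ⟨A, hA, rfl⟩ := Finset.mem_image.1 hX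
  rw [Finset.mem_sdiff] at hA
  unfold Kfam at hA
  rw [Finset.mem_filter] at hA
  exact fimage_sep hn (h𝒜 hA.1) (by tauto) (by tauto)

lemma K_sub {n r : ℕ} (hn : 4 ≤ n) {𝒜 : Finset (Finset ℕ)} (h𝒜 : 𝒜 ⊆ sepSets n 1 r) :
    (Kfam n 𝒜).image gset ⊆ sepSets (n - 2) 1 (r - 1) := by
  intro X hX
  obtain ⟨A, hA, rfl⟩ := Finset.mem_image.1 hX
  exact gset_sep hn (h𝒜 (Finset.mem_of_mem_filter _ hA)) (K_mem12 hA)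

lemma card_split {n r : ℕ} (hn : 4 ≤ n) {𝒜 : Finset (Finset ℕ)} (h𝒜 : 𝒜 ⊆ sepSets n 1 r) :
    𝒜.card = ((𝒜 \ Kfam n 𝒜).image (fun A : Finset ℕ => A.image fmap)).card +
      ((Kfam n 𝒜).image gset).card := by
  rw [Finset.card_image_of_injOn (L_inj hn h𝒜), Finset.card_image_of_injOn (K_injOn hn h𝒜)]
  exact (Finset.card_sdiff_add_card_eq_card (Finset.filter_subset _ _)).symm

lemma Intersecting.mono {𝒜 ℬ : Finset (Finset ℕ)} (h : ℬ ⊆ 𝒜) (hint : Intersecting 𝒜) :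
    Intersecting ℬ := fun A hA B hB => hint A (h hA) B (h hB)

lemma upper (n : ℕ) : ∀ r, 1 ≤ r → 2 ≤ n → ∀ 𝒜 : Finset (Finset ℕ), 𝒜 ⊆ sepSets n 1 r →
    Intersecting 𝒜 → 𝒜.card ≤ (n - r - 1).choose (r - 1) := by
  induction n using Nat.strong_induction_on with
  | _ n ih =>
    intro r hr hn 𝒜 h𝒜 hint
    by_cases hr1 : r = 1
    · subst hr1
      simpa using card_le_one_of_r1 hn h𝒜 hint
    by_cases hnr : n < 2 * r
    · have : 𝒜 = ∅ := by
        rw [Finset.eq_empty_iff_forall_notMem]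
        intro A hA
        have := sep_bound hn hr (h𝒜 hA)
        omega
      simp [this]
    have hn4 : 4 ≤ n := by omega
    rw [card_split hn4 h𝒜]
    have b1 := ih (n - 1) (by omega) r hr (by omega) _ (L_sub hn4 h𝒜)
      (f_int (hint.mono Finset.sdiff_subset))
    have b2 := ih (n - 2) (by omega) (r - 1) (by omega) (by omega) _ (K_sub hn4 h𝒜)
      (K_int hn4 h𝒜 hint)
    obtain ⟨s, rfl⟩ : ∃ s, r = s + 2 := ⟨r - 2, by omega⟩
    obtain ⟨m, rfl⟩ : ∃ m, n = m + s + 4 := ⟨n - s - 4, by omega⟩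
    rw [show m + s + 4 - 1 - (s + 2) - 1 = m by omega, show s + 2 - 1 = s + 1 by omega] at b1
    rw [show m + s + 4 - 2 - (s + 2 - 1) - 1 = m by omega, show s + 2 - 1 - 1 = s by omega] at b2
    rw [show m + s + 4 - (s + 2) - 1 = m + 1 by omega, show s + 2 - 1 = s + 1 by omega,
      Nat.choose_succ_succ']
    omega

/-- cyclic successor -/
def cs (n x : ℕ) : ℕ := if x = n then 1 else x + 1

lemma mem_sep' {n r : ℕ} (hn : 2 ≤ n) (A : Finset ℕ) :
    A ∈ sepSets n 1 r ↔ (∀ a ∈ A, 1 ≤ a ∧ a ≤ n) ∧ A.card = r ∧ (∀ a ∈ A, cs n a ∉ A) := by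
  rw [mem_sep hn]
  constructor
  · rintro ⟨h1, h2, h3, h4⟩
    refine ⟨h1, h2, ?_⟩
    intro a ha hb
    unfold cs at hb
    split_ifs at hb with h
    · subst h; exact h4 hb ha
    · exact h3 a ha hb
  · rintro ⟨h1, h2, h3⟩
    refine ⟨h1, h2, ?_, ?_⟩
    · intro a ha hb
      have := h1 _ hb
      have h := h3 a ha
      unfold cs at h
      rw [if_neg (by omega)] at h
      exact h hb
    · intro ha hb
      have h := h3 n hb
      unfold cs at h
      rw [if_pos rfl] at h
      exact h ha

lemma exists_pred {n : ℕ} (X : Finset ℕ) (h1 : ∀ a ∈ X, 1 ≤ a ∧ a ≤ n) :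
    ∃ π : ℕ → ℕ, (∀ x ∈ X, π x = x) ∧ ∀ y, y ≤ n → cs n y ∉ X → π (cs n y) = π y := by
  refine ⟨fun y => if (X.filter (· ≤ y)).sup id = 0 then X.sup id
    else (X.filter (· ≤ y)).sup id, ?_, ?_⟩
  · intro x hx
    have : (X.filter (· ≤ x)).sup id = x := by
      apply le_antisymm
      · apply Finset.sup_le
        intro y hy
        exact (Finset.mem_filter.1 hy).2
      · exact Finset.le_sup (f := id) (Finset.mem_filter.2 ⟨hx, le_refl x⟩)
    have h := h1 x hx
    simp only [this]
    rw [if_neg (by omega)]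
  · intro y hy hcs
    unfold cs at hcs ⊢
    split_ifs at hcs ⊢ with h
    · subst h
      have e1 : X.filter (· ≤ 1) = ∅ := by
        rw [Finset.filter_eq_empty_iff]
        intro x hx hx1
        have := h1 x hx
        have : x = 1 := by omega
        subst this
        exact hcs hx
      have e2 : X.filter (· ≤ y) = X := by
        rw [Finset.filter_eq_self]
        intro x hx
        exact (h1 x hx).2
      simp [e1, e2]
    · have : X.filter (· ≤ y + 1) = X.filter (· ≤ y) := by
        apply Finset.filter_congr
        intro x hx
        have : x ≠ y + 1 := by rintro rfl; exact hcs hx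
        omega
      simp only [this]

lemma cs_inj {n a b : ℕ} (ha : 1 ≤ a ∧ a ≤ n) (hb : 1 ≤ b ∧ b ≤ n) (h : cs n a = cs n b) :
    a = b := by
  unfold cs at h
  split_ifs at h <;> omega

lemma cs_mem {n a : ℕ} (ha : 1 ≤ a ∧ a ≤ n) : 1 ≤ cs n a ∧ cs n a ≤ n := by
  unfold cs
  split_ifs <;> omega

lemma exists_disjoint {n r : ℕ} (hn : 2 ≤ n) (hr : 2 ≤ r) {X : Finset ℕ} (hX : X ∈ sepSets n 1 r)
    {p q : ℕ} (hp : 1 ≤ p ∧ p ≤ n) (hq : 1 ≤ q ∧ q ≤ n) (hpX : p ∉ X) (hqX : q ∉ X)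
    (hpq : p ≠ q) (hpq1 : cs n p ≠ q) (hpq2 : cs n q ≠ p) :
    ∃ A ∈ sepSets n 1 r, p ∈ A ∧ q ∈ A ∧ ∀ x ∈ A, x ∉ X := by
  obtain ⟨h1, h2, h3⟩ := (mem_sep' hn X).1 hX
  obtain ⟨π, hπ1, hπ2⟩ := exists_pred X h1
  have hπs : ∀ z ∈ X, π (cs n z) = z := by
    intro z hz
    rw [hπ2 z (h1 z hz).2 (h3 z hz), hπ1 z hz]
  have hc : r - 2 ≤ ((X.erase (π p)).erase (π q)).card := by
    have a1 := Finset.pred_card_le_card_erase (s := X) (a := π p)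
    have a2 := Finset.pred_card_le_card_erase (s := X.erase (π p)) (a := π q)
    omega
  obtain ⟨Z, hZ, hZc⟩ := Finset.exists_subset_card_eq hc
  have hZX : ∀ z ∈ Z, z ∈ X ∧ z ≠ π p ∧ z ≠ π q := by
    intro z hz
    have := hZ hz
    simp only [Finset.mem_erase] at this
    exact ⟨this.2.2, this.2.1, this.1⟩
  have hmem : ∀ x, x ∈ insert p (insert q (Z.image (cs n))) ↔ x = p ∨ x = q ∨ ∃ z ∈ Z, cs n z = x := by
    intro x
    simp only [Finset.mem_insert, Finset.mem_image]
  refine ⟨insert p (insert q (Z.image (cs n))), ?_, by simp, by simp, ?_⟩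
  · rw [mem_sep' hn]
    refine ⟨?_, ?_, ?_⟩
    · intro a ha
      rcases (hmem a).1 ha with rfl | rfl | ⟨z, hz, rfl⟩
      · exact hp
      · exact hq
      · exact cs_mem (h1 z (hZX z hz).1)
    · rw [Finset.card_insert_of_notMem, Finset.card_insert_of_notMem, Finset.card_image_of_injOn, hZc]
      · omega
      · intro a ha b hb hab
        exact cs_inj (h1 _ (hZX _ ha).1) (h1 _ (hZX _ hb).1) hab
      · intro h
        obtain ⟨z, hz, rfl⟩ := Finset.mem_image.1 h
        have := hZX z hz
        rw [hπs z this.1] at this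
        exact this.2.2 rfl
      · intro h
        rcases Finset.mem_insert.1 h with h | h
        · exact hpq h
        obtain ⟨z, hz, rfl⟩ := Finset.mem_image.1 h
        have := hZX z hz
        rw [hπs z this.1] at this
        exact this.2.1 rfl
    · have aux : ∀ w, 1 ≤ w ∧ w ≤ n → w ∉ X → ∀ z ∈ Z, z ≠ π w →
          cs n w ≠ cs n z ∧ cs n (cs n z) ≠ w := by
        intro w hw hwX z hz hzw
        have hzX := (hZX z hz).1
        refine ⟨?_, ?_⟩
        · intro h
          have := cs_inj hw (h1 z hzX) h
          subst this
          exact hwX hzX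
        · rintro rfl
          rw [hπ2 _ (cs_mem (h1 z hzX)).2 hwX, hπs z hzX] at hzw
          exact hzw rfl
      have self : ∀ w, 1 ≤ w ∧ w ≤ n → cs n w ≠ w := by
        intro w hw
        unfold cs
        split_ifs <;> omega
      intro a ha hb
      rcases (hmem a).1 ha with rfl | rfl | ⟨z, hz, rfl⟩ <;>
        rcases (hmem _).1 hb with hb | hb | ⟨z', hz', hb⟩
      · exact self _ hp hb
      · exact hpq1 hb
      · exact (aux _ hp hpX z' hz' (hZX z' hz').2.1).1 hb.symm
      · exact hpq2 hb
      · exact self _ hq hb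
      · exact (aux _ hq hqX z' hz' (hZX z' hz').2.2).1 hb.symm
      · exact (aux _ hp hpX z hz (hZX z hz).2.1).2 hb
      · exact (aux _ hq hqX z hz (hZX z hz).2.2).2 hb
      · have := cs_inj (h1 _ (hZX _ hz').1) (cs_mem (h1 _ (hZX _ hz).1)) hb
        exact h3 z (hZX z hz).1 (this ▸ (hZX _ hz').1)
  · intro x hx
    rcases (hmem x).1 hx with rfl | rfl | ⟨z, hz, rfl⟩
    · exact hpX
    · exact hqX
    · exact h3 z (hZX z hz).1

/-- Sets through 1 but not 3. -/
def Pfam (n r : ℕ) : Finset (Finset ℕ) := (sepSets n 1 r).filter fun A => 1 ∈ A ∧ 3 ∉ A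

/-- Sets through 3 but not 1. -/
def Qfam (n r : ℕ) : Finset (Finset ℕ) := (sepSets n 1 r).filter fun A => 3 ∈ A ∧ 1 ∉ A

def phi (A : Finset ℕ) : Finset ℕ := insert 3 ((A.erase 1).image (· + 1))

def psi (A : Finset ℕ) : Finset ℕ := insert 1 ((A.erase 3).image (· - 1))

lemma mem_P {n r : ℕ} (hn : 4 ≤ n) (A : Finset ℕ) : A ∈ Pfam n r ↔ 1 ∈ A ∧ A.card = r ∧
    (∀ a ∈ A, a + 1 ∉ A) ∧ (∀ a ∈ A, a = 1 ∨ (4 ≤ a ∧ a < n)) := by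
  unfold Pfam
  rw [Finset.mem_filter, mem_sep (by omega)]
  constructor
  · rintro ⟨⟨h1, h2, h3, h4⟩, h5, h6⟩
    refine ⟨h5, h2, h3, ?_⟩
    intro a ha
    have := h1 a ha
    have : a ≠ n := by rintro rfl; exact h4 h5 ha
    have : a ≠ 2 := by rintro rfl; exact h3 1 h5 ha
    have : a ≠ 3 := by rintro rfl; exact h6 ha
    omega
  · rintro ⟨h1, h2, h3, h4⟩
    refine ⟨⟨?_, h2, h3, ?_⟩, h1, ?_⟩
    · intro a ha; have := h4 a ha; omega
    · intro _ ha; have := h4 _ ha; omega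
    · intro ha; have := h4 _ ha; omega

lemma mem_Q {n r : ℕ} (hn : 4 ≤ n) (A : Finset ℕ) : A ∈ Qfam n r ↔ 3 ∈ A ∧ A.card = r ∧
    (∀ a ∈ A, a + 1 ∉ A) ∧ (∀ a ∈ A, a = 3 ∨ (5 ≤ a ∧ a ≤ n)) := by
  unfold Qfam
  rw [Finset.mem_filter, mem_sep (by omega)]
  constructor
  · rintro ⟨⟨h1, h2, h3, h4⟩, h5, h6⟩
    refine ⟨h5, h2, h3, ?_⟩
    intro a ha
    have := h1 a ha
    have : a ≠ 1 := by rintro rfl; exact h6 ha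
    have : a ≠ 2 := by rintro rfl; exact h3 2 ha h5
    have : a ≠ 4 := by rintro rfl; exact h3 3 h5 ha
    omega
  · rintro ⟨h1, h2, h3, h4⟩
    refine ⟨⟨?_, h2, h3, ?_⟩, h1, ?_⟩
    · intro a ha; have := h4 a ha; omega
    · intro ha; have := h4 _ ha; omega
    · intro ha; have := h4 _ ha; omega

lemma mem_phi (A : Finset ℕ) (y : ℕ) (h0 : 0 ∉ A) : y ∈ phi A ↔ y = 3 ∨ (3 ≤ y ∧ y - 1 ∈ A) := by
  unfold phi
  simp only [Finset.mem_insert, Finset.mem_image, Finset.mem_erase]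
  constructor
  · rintro (h | ⟨x, ⟨hx, hx'⟩, rfl⟩)
    · exact Or.inl h
    · right
      have : x ≠ 0 := by rintro rfl; exact h0 hx'
      exact ⟨by omega, by simpa using hx'⟩
  · rintro (h | ⟨h, h'⟩)
    · exact Or.inl h
    · exact Or.inr ⟨y - 1, ⟨by omega, h'⟩, by omega⟩

lemma P_zero {n r : ℕ} (hn : 4 ≤ n) {A : Finset ℕ} (hA : A ∈ Pfam n r) : 0 ∉ A := by
  intro h
  have := ((mem_P hn A).1 hA).2.2.2 0 h
  omega

lemma phi_Q {n r : ℕ} (hn : 4 ≤ n) {A : Finset ℕ} (hA : A ∈ Pfam n r) : phi A ∈ Qfam n r := by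
  have h0 := P_zero hn hA
  obtain ⟨h1, h2, h3, h4⟩ := (mem_P hn A).1 hA
  rw [mem_Q hn]
  have h24 : 2 ∉ A := fun h => by have := h4 _ h; omega
  refine ⟨by simp [phi], ?_, ?_, ?_⟩
  · unfold phi
    rw [Finset.card_insert_of_notMem, Finset.card_image_of_injective, Finset.card_erase_of_mem h1, h2]
    · have : 0 < A.card := Finset.card_pos.2 ⟨1, h1⟩
      omega
    · intro a b h; simpa using h
    · intro h
      obtain ⟨x, hx, hx'⟩ := Finset.mem_image.1 h
      have := h4 x (Finset.mem_of_mem_erase hx)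
      have := (Finset.mem_erase.1 hx).1
      omega
  · intro a ha hb
    rcases (mem_phi A a h0).1 ha with rfl | ⟨ha1, ha2⟩
    · rcases (mem_phi A _ h0).1 hb with hb | ⟨hb1, hb2⟩
      · omega
      · have := h4 _ hb2; omega
    · rcases (mem_phi A _ h0).1 hb with hb | ⟨hb1, hb2⟩
      · omega
      · apply h3 _ ha2
        rwa [show a - 1 + 1 = a + 1 - 1 by omega]
  · intro a ha
    rcases (mem_phi A a h0).1 ha with rfl | ⟨ha1, ha2⟩
    · left; rfl
    · have := h4 _ ha2
      omega

lemma mem_psi (A : Finset ℕ) (y : ℕ) (h0 : ∀ a ∈ A, 3 ≤ a) :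
    y ∈ psi A ↔ y = 1 ∨ (3 ≤ y ∧ y + 1 ∈ A) := by
  unfold psi
  simp only [Finset.mem_insert, Finset.mem_image, Finset.mem_erase]
  constructor
  · rintro (h | ⟨x, ⟨hx, hx'⟩, rfl⟩)
    · exact Or.inl h
    · right
      have := h0 x hx'
      exact ⟨by omega, by rwa [show x - 1 + 1 = x by omega]⟩
  · rintro (h | ⟨h, h'⟩)
    · exact Or.inl h
    · exact Or.inr ⟨y + 1, ⟨by omega, h'⟩, by omega⟩

lemma psi_P {n r : ℕ} (hn : 4 ≤ n) {A : Finset ℕ} (hA : A ∈ Qfam n r) :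
    psi A ∈ Pfam n r ∧ phi (psi A) = A := by
  obtain ⟨h1, h2, h3, h4⟩ := (mem_Q hn A).1 hA
  have h0 : ∀ a ∈ A, 3 ≤ a := fun a ha => by have := h4 a ha; omega
  refine ⟨?_, ?_⟩
  · rw [mem_P hn]
    refine ⟨by simp [psi], ?_, ?_, ?_⟩
    · unfold psi
      rw [Finset.card_insert_of_notMem, Finset.card_image_of_injOn, Finset.card_erase_of_mem h1, h2]
      · have : 0 < A.card := Finset.card_pos.2 ⟨3, h1⟩
        omega
      · intro a ha b hb h
        have := h0 a (Finset.mem_of_mem_erase ha)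
        have := h0 b (Finset.mem_of_mem_erase hb)
        simp only at h
        omega
      · intro h
        obtain ⟨x, hx, hx'⟩ := Finset.mem_image.1 h
        have := h0 x (Finset.mem_of_mem_erase hx)
        omega
    · intro a ha hb
      rcases (mem_psi A a h0).1 ha with rfl | ⟨ha1, ha2⟩
      · rcases (mem_psi A _ h0).1 hb with hb | ⟨hb1, hb2⟩
        · omega
        · omega
      · rcases (mem_psi A _ h0).1 hb with hb | ⟨hb1, hb2⟩
        · omega
        · exact h3 _ ha2 hb2
    · intro a ha
      rcases (mem_psi A a h0).1 ha with rfl | ⟨ha1, ha2⟩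
      · left; rfl
      · have := h4 _ ha2
        omega
  · ext y
    rw [mem_phi, mem_psi A _ h0]
    · constructor
      · rintro (rfl | ⟨hy, hy' | ⟨hy1, hy2⟩⟩)
        · exact h1
        · omega
        · rwa [show y - 1 + 1 = y by omega] at hy2
      · intro hy
        have := h4 y hy
        by_cases e : y = 3
        · exact Or.inl e
        · refine Or.inr ⟨by omega, Or.inr ⟨by omega, ?_⟩⟩
          rwa [show y - 1 + 1 = y by omega]
    · rw [mem_psi A _ h0]
      omega

lemma phi_inj {n r : ℕ} (hn : 4 ≤ n) {A B : Finset ℕ} (hA : A ∈ Pfam n r) (hB : B ∈ Pfam n r)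
    (h : phi A = phi B) : A = B := by
  have key : ∀ A ∈ Pfam n r, ∀ B ∈ Pfam n r, phi A = phi B → A ⊆ B := by
    intro A hA B hB h x hx
    obtain ⟨h1, h2, h3, h4⟩ := (mem_P hn A).1 hA
    rcases h4 x hx with rfl | hx4
    · exact ((mem_P hn B).1 hB).1
    · have : x + 1 ∈ phi A := by
        rw [mem_phi A _ (P_zero hn hA)]
        exact Or.inr ⟨by omega, by simpa using hx⟩
      rw [h, mem_phi B _ (P_zero hn hB)] at this
      rcases this with h | h
      · omega
      · simpa using h.2
  exact Finset.Subset.antisymm (key A hA B hB h) (key B hB A hA h.symm)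

lemma phi_disj {n r : ℕ} (hn : 4 ≤ n) {A : Finset ℕ} (hA : A ∈ Pfam n r) :
    ∀ x ∈ phi A, x ∉ A := by
  obtain ⟨h1, h2, h3, h4⟩ := (mem_P hn A).1 hA
  intro x hx hx'
  rcases (mem_phi A x (P_zero hn hA)).1 hx with rfl | ⟨ha1, ha2⟩
  · have := h4 _ hx'; omega
  · apply h3 _ ha2
    rwa [show x - 1 + 1 = x by omega]

lemma star_int (n r i : ℕ) : Intersecting ((sepSets n 1 r).filter fun A => i ∈ A) := by
  intro A hA B hB
  exact ⟨i, Finset.mem_inter.2 ⟨(Finset.mem_filter.1 hA).2, (Finset.mem_filter.1 hB).2⟩⟩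

lemma closure13 {n r : ℕ} (hn : 4 ≤ n) (hr : 1 ≤ r) {𝒜 : Finset (Finset ℕ)}
    (h𝒜 : 𝒜 ⊆ sepSets n 1 r) (hint : Intersecting 𝒜)
    (hcard : 𝒜.card = (n - r - 1).choose (r - 1))
    (H : ∀ A ∈ 𝒜, 1 ∈ A ∨ 3 ∈ A) {A A' : Finset ℕ} (hA : A ∈ 𝒜)
    (hA' : A' ∈ Pfam n r) (hd : ∀ x ∈ phi A', x ∉ A) : A' ∈ 𝒜 := by
  have hnd : ∀ X ∈ 𝒜, ∀ Y ∈ 𝒜, ¬ ∀ x ∈ X, x ∉ Y := by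
    intro X hX Y hY h
    obtain ⟨x, hx⟩ := hint X hX Y hY
    rw [Finset.mem_inter] at hx
    exact h x hx.1 hx.2
  set C := (sepSets n 1 r).filter fun A => 1 ∈ A ∧ 3 ∈ A with hC
  set U := 𝒜.filter fun A => 1 ∈ A ∧ 3 ∉ A with hU
  set V := 𝒜.filter fun A => 3 ∈ A ∧ 1 ∉ A with hV
  have hUP : ∀ X ∈ U, X ∈ Pfam n r := by
    intro X hX
    rw [hU, Finset.mem_filter] at hX
    exact Finset.mem_filter.2 ⟨h𝒜 hX.1, hX.2⟩
  have hVQ : ∀ X ∈ V, X ∈ Qfam n r := by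
    intro X hX
    rw [hV, Finset.mem_filter] at hX
    exact Finset.mem_filter.2 ⟨h𝒜 hX.1, hX.2⟩
  have e1 : 𝒜 ⊆ C ∪ (U ∪ V) := by
    intro X hX
    have := H X hX
    have := h𝒜 hX
    simp only [hC, hU, hV, Finset.mem_union, Finset.mem_filter]
    tauto
  have e2 : (sepSets n 1 r).filter (fun A => 3 ∈ A) = C ∪ Qfam n r := by
    ext X
    simp only [hC, Qfam, Finset.mem_union, Finset.mem_filter]
    tauto
  have e2d : Disjoint C (Qfam n r) := by
    rw [Finset.disjoint_left]
    intro X hX hX'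
    rw [hC, Finset.mem_filter] at hX
    unfold Qfam at hX'
    rw [Finset.mem_filter] at hX'
    exact hX'.2.2 hX.2.1
  have b1 := upper n r hr (by omega) _ (Finset.filter_subset _ _) (star_int n r 3)
  rw [e2, Finset.card_union_of_disjoint e2d, ← hcard] at b1
  have b2 := Finset.card_le_card e1
  have b3 := Finset.card_union_le C (U ∪ V)
  have b4 := Finset.card_union_le U V
  have cU : (U.image phi).card = U.card := by
    apply Finset.card_image_of_injOn
    intro X hX Y hY h
    exact phi_inj hn (hUP X hX) (hUP Y hY) h
  have dUV : Disjoint (U.image phi) V := by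
    rw [Finset.disjoint_left]
    intro X hX hX'
    obtain ⟨Y, hY, rfl⟩ := Finset.mem_image.1 hX
    exact hnd _ (Finset.mem_of_mem_filter _ hX') _ (Finset.mem_of_mem_filter _ hY)
      (phi_disj hn (hUP Y hY))
  have sub : U.image phi ∪ V ⊆ Qfam n r := by
    intro X hX
    rcases Finset.mem_union.1 hX with hX | hX
    · obtain ⟨Y, hY, rfl⟩ := Finset.mem_image.1 hX
      exact phi_Q hn (hUP Y hY)
    · exact hVQ X hX
  have heq : U.image phi ∪ V = Qfam n r := by
    apply Finset.eq_of_subset_of_card_le sub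
    rw [Finset.card_union_of_disjoint dUV, cU]
    omega
  have := phi_Q hn hA'
  rw [← heq] at this
  rcases Finset.mem_union.1 this with h | h
  · obtain ⟨Y, hY, hYA⟩ := Finset.mem_image.1 h
    rw [← phi_inj hn (hUP Y hY) hA' hYA]
    exact Finset.mem_of_mem_filter _ hY
  · exact (hnd _ (Finset.mem_of_mem_filter _ h) _ hA hd).elim

lemma replace_P {n r : ℕ} (hn : 4 ≤ n) {T : Finset ℕ} (hT : T ∈ Pfam n r) {t y : ℕ} (ht : t ∈ T)
    (ht1 : t ≠ 1) (hy : y ∉ T) (hy4 : 4 ≤ y) (hyn : y < n) (hy1 : y - 1 ∈ T → y - 1 = t)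
    (hy2 : y + 1 ∈ T → y + 1 = t) : insert y (T.erase t) ∈ Pfam n r := by
  obtain ⟨h1, h2, h3, h4⟩ := (mem_P hn T).1 hT
  rw [mem_P hn]
  refine ⟨?_, ?_, ?_, ?_⟩
  · simp only [Finset.mem_insert, Finset.mem_erase]
    exact Or.inr ⟨fun h => ht1 h.symm, h1⟩
  · rw [Finset.card_insert_of_notMem (fun h => hy (Finset.mem_of_mem_erase h)),
      Finset.card_erase_of_mem ht, h2]
    have : 0 < T.card := Finset.card_pos.2 ⟨t, ht⟩
    omega
  · intro a ha hb
    simp only [Finset.mem_insert, Finset.mem_erase] at ha hb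
    rcases ha with rfl | ⟨ha1, ha2⟩
    · rcases hb with hb | ⟨hb1, hb2⟩
      · omega
      · exact hb1 (hy2 hb2)
    · rcases hb with hb | ⟨hb1, hb2⟩
      · have : a = y - 1 := by omega
        subst this
        exact ha1 (hy1 ha2)
      · exact h3 a ha2 hb2
  · intro a ha
    simp only [Finset.mem_insert, Finset.mem_erase] at ha
    rcases ha with rfl | ⟨ha1, ha2⟩
    · right; omega
    · exact h4 a ha2

lemma sum_replace {T : Finset ℕ} {t y : ℕ} (ht : t ∈ T) (hy : y ∉ T) :
    (insert y (T.erase t)).sum id + t = T.sum id + y := by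
  rw [Finset.sum_insert (fun h => hy (Finset.mem_of_mem_erase h))]
  have := Finset.add_sum_erase T id ht
  simp only [id] at *
  omega

/-- Connectivity, abstractly: a family of sets closed under the moves. -/
lemma connect {n r : ℕ} (hr : 2 ≤ r) (hnr : 2 * r + 3 ≤ n) {𝒰 : Finset (Finset ℕ)}
    (hU : 𝒰 ⊆ Pfam n r)
    (hcl : ∀ A ∈ 𝒰, ∀ A' ∈ Pfam n r, (∀ x ∈ phi A', x ∉ A) → A' ∈ 𝒰) (hne : 𝒰.Nonempty) :
    ∀ A ∈ Pfam n r, A ∈ 𝒰 := by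
  have hn : 4 ≤ n := by omega
  have rep : ∀ T ∈ 𝒰, ∀ t ∈ T, ∀ y, t ≠ 1 → y ∉ T → 4 ≤ y → y < n → (y - 1 ∈ T → y - 1 = t) →
      y + 1 ∉ T → insert y (T.erase t) ∈ 𝒰 := by
    intro T hT t ht y ht1 hy hy4 hyn hy1 hy2
    have hP := replace_P hn (hU hT) ht ht1 hy hy4 hyn hy1 (fun h => (hy2 h).elim)
    refine hcl T hT _ hP ?_
    obtain ⟨h1, h2, h3, h4⟩ := (mem_P hn T).1 (hU hT)
    intro x hx hxT
    rcases (mem_phi _ x (P_zero hn hP)).1 hx with rfl | ⟨ha1, ha2⟩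
    · have := h4 _ hxT; omega
    · simp only [Finset.mem_insert, Finset.mem_erase] at ha2
      rcases ha2 with h | ⟨h, h'⟩
      · apply hy2
        rwa [show y + 1 = x by omega]
      · apply h3 _ h'
        rwa [show x - 1 + 1 = x by omega]
  have seg : ∀ j, 1 ≤ j → j ≤ r → ∃ T ∈ 𝒰, ∀ i, 2 ≤ i → i ≤ j → 2 * i ∈ T := by
    intro j hj
    induction j, hj using Nat.le_induction with
    | base =>
      intro _
      obtain ⟨T, hT⟩ := hne
      exact ⟨T, hT, fun i h1 h2 => by omega⟩
    | succ j hj ih =>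
      intro hjr
      obtain ⟨T0, hT0, hT0s⟩ := ih (by omega)
      obtain ⟨T, hTm, hTmax⟩ := Finset.exists_max_image
        (𝒰.filter fun T => ∀ i ∈ Finset.Icc 2 j, 2 * i ∈ T) (fun T => T.sum id)
        ⟨T0, Finset.mem_filter.2 ⟨hT0, fun i hi => by
          rw [Finset.mem_Icc] at hi; exact hT0s i hi.1 hi.2⟩⟩
      rw [Finset.mem_filter] at hTm
      obtain ⟨hT, hTs⟩ := hTm
      have hTs' : ∀ i, 2 ≤ i → i ≤ j → 2 * i ∈ T := fun i h1 h2 =>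
        hTs i (Finset.mem_Icc.2 ⟨h1, h2⟩)
      obtain ⟨h1, h2, h3, h4⟩ := (mem_P hn T).1 (hU hT)
      by_cases hj1 : 2 * (j + 1) ∈ T
      · refine ⟨T, hT, fun i hi1 hi2 => ?_⟩
        by_cases e : i = j + 1
        · rw [e]; exact hj1
        · exact hTs' i hi1 (by omega)
      have up : ∀ t ∈ T, 2 * j < t → t < n - 1 → t + 2 ∈ T := by
        intro t ht htj htn
        by_contra hno
        have h4t := h4 t ht
        have hnew := rep T hT t ht (t + 1) (by omega) (h3 t ht) (by omega) (by omega)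
          (fun _ => by omega) hno
        have hle := hTmax _ (Finset.mem_filter.2 ⟨hnew, fun i hi => by
          rw [Finset.mem_Icc] at hi
          simp only [Finset.mem_insert, Finset.mem_erase]
          exact Or.inr ⟨by omega, hTs' i hi.1 hi.2⟩⟩)
        have := sum_replace (y := t + 1) ht (h3 t ht)
        omega
      have hex : ∃ t, t ∈ T ∧ 2 * j < t := by
        by_contra hno
        push Not at hno
        have := path_bound (m := 2 * j) T (fun a ha => ⟨by
          have := h4 a ha; omega, hno a ha⟩) h3
        omega
      classical
      obtain ⟨ht, htj⟩ := Nat.find_spec hex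
      have htmin : ∀ m, m ∈ T → 2 * j < m → Nat.find hex ≤ m := fun m hm hm' =>
        Nat.find_min' hex ⟨hm, hm'⟩
      generalize Nat.find hex = t at ht htj htmin
      have hj1' : 2 * j + 1 ∉ T := by
        by_cases e : j = 1
        · subst e
          intro h
          have := h4 _ h
          omega
        · exact h3 _ (hTs' j (by omega) (le_refl _))
      have n1 : t ≠ 2 * j + 1 := by rintro rfl; exact hj1' ht
      have n2 : t ≠ 2 * j + 2 := by rintro rfl; exact hj1 ht
      have n3 : t ≠ 2 * j + 3 := by
        intro e
        have chain : ∀ i, t + 2 * i ≤ n → t + 2 * i ∈ T := by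
          intro i
          induction i with
          | zero => intro _; simpa using ht
          | succ i ihi =>
            intro hi
            have := up _ (ihi (by omega)) (by omega) (by omega)
            rwa [show t + 2 * (i + 1) = t + 2 * i + 2 by omega]
        have hc : ((Finset.range (r + 1)).image
            (fun i => if i = 0 then 1 else if i < j then 2 * i + 2 else 2 * i + 3)) ⊆ T := by
          intro x hx
          obtain ⟨i, hi, rfl⟩ := Finset.mem_image.1 hx
          rw [Finset.mem_range] at hi
          split_ifs with c1 c2
          · exact h1
          · exact hTs' (i + 1) (by omega) (by omega)
          · have := chain (i - j) (by omega)
            rwa [show t + 2 * (i - j) = 2 * i + 3 by omega] at this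
        have := Finset.card_le_card hc
        rw [Finset.card_image_of_injOn, Finset.card_range] at this
        · omega
        · intro a _ b _ hab
          simp only at hab
          split_ifs at hab <;> omega
      have hj3 : 2 * j + 3 ∉ T := by
        intro h
        have := htmin _ h (by omega)
        omega
      have h4t := h4 t ht
      have hnew := rep T hT t ht (2 * (j + 1)) (by omega) hj1 (by omega) (by omega)
        (fun h => (hj1' (by rwa [show 2 * (j + 1) - 1 = 2 * j + 1 by omega] at h)).elim) hj3
      refine ⟨_, hnew, fun i hi1 hi2 => ?_⟩
      simp only [Finset.mem_insert, Finset.mem_erase]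
      by_cases e : i = j + 1
      · left; rw [e]
      · exact Or.inr ⟨by omega, hTs' i hi1 (by omega)⟩
  obtain ⟨W, hW, hWs⟩ := seg r (by omega) (le_refl _)
  have uniq : ∀ A ∈ Pfam n r, (∀ i, 2 ≤ i → i ≤ r → 2 * i ∈ A) →
      insert 1 ((Finset.Icc 2 r).image (2 * ·)) = A := by
    intro A hA hAs
    obtain ⟨h1, h2, h3, h4⟩ := (mem_P hn A).1 hA
    apply Finset.eq_of_subset_of_card_le
    · intro x hx
      rcases Finset.mem_insert.1 hx with rfl | hx
      · exact h1
      · obtain ⟨i, hi, rfl⟩ := Finset.mem_image.1 hx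
        rw [Finset.mem_Icc] at hi
        exact hAs i hi.1 hi.2
    · rw [Finset.card_insert_of_notMem, Finset.card_image_of_injective, Nat.card_Icc, h2]
      · omega
      · intro a b h
        simpa using h
      · intro h
        obtain ⟨i, hi, hi'⟩ := Finset.mem_image.1 h
        omega
  have main : ∀ s, ∀ A ∈ Pfam n r, A.sum id = s → A ∈ 𝒰 := by
    intro s
    induction s using Nat.strong_induction_on with
    | _ s ih =>
      intro A hA hs
      obtain ⟨h1, h2, h3, h4⟩ := (mem_P hn A).1 hA
      by_cases hbot : ∃ t ∈ A, 5 ≤ t ∧ t - 2 ∉ A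
      · obtain ⟨t, ht, ht5, ht2⟩ := hbot
        have htn := h4 t ht
        have hy : t - 1 ∉ A := fun h => h3 _ h (by rwa [show t - 1 + 1 = t by omega])
        have hP := replace_P hn hA (y := t - 1) ht (by omega) hy (by omega) (by omega)
          (fun h => (ht2 (by rwa [show t - 1 - 1 = t - 2 by omega] at h)).elim) (fun _ => by omega)
        have hsum := sum_replace (y := t - 1) ht hy
        have hin := ih _ (by omega) _ hP rfl
        have := rep _ hin (t - 1) (by simp) t (by omega) (by
          simp only [Finset.mem_insert, Finset.mem_erase]
          rintro (h | h)
          · omega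
          · exact h.1 rfl) (by omega) (by omega) (fun _ => rfl) (by
          simp only [Finset.mem_insert, Finset.mem_erase]
          rintro (h | h)
          · omega
          · exact h3 t ht h.2)
        convert this using 1
        ext x
        simp only [Finset.mem_insert, Finset.mem_erase]
        constructor
        · intro hx
          by_cases e : x = t
          · exact Or.inl e
          · refine Or.inr ⟨?_, Or.inr ⟨e, hx⟩⟩
            rintro rfl
            exact hy hx
        · rintro (rfl | ⟨h, h' | h'⟩)
          · exact ht
          · exact (h h').elim
          · exact h'.2
      · push Not at hbot
        have hAs : ∀ i, 2 ≤ i → i ≤ r → 2 * i ∈ A := by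
          intro i hi2 hir
          by_contra hno
          have key : ∀ t, t ∈ A → t = 1 ∨ (t % 2 = 0 ∧ t < 2 * i) := by
            intro t
            induction t using Nat.strong_induction_on with
            | _ t iht =>
              intro ht
              rcases h4 t ht with h | h
              · exact Or.inl h
              right
              have : t ≠ 2 * i := by rintro rfl; exact hno ht
              by_cases h5 : 5 ≤ t
              · have := iht (t - 2) (by omega) (hbot t ht h5)
                omega
              · omega
          have := path_bound (m := 2 * i - 2) A (fun a ha => by
            have := key a ha
            have := h4 a ha
            omega) h3
          omega
        rw [← uniq A hA hAs, uniq W (hU hW) hWs]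
        exact hW
  exact fun A hA => main _ A hA rfl

lemma star13 {n r : ℕ} (hr : 2 ≤ r) (hnr : 2 * r < n) (hne : n ≠ 2 * r + 2)
    {𝒜 : Finset (Finset ℕ)} (h𝒜 : 𝒜 ⊆ sepSets n 1 r) (hint : Intersecting 𝒜)
    (hcard : 𝒜.card = (n - r - 1).choose (r - 1))
    (H : ∀ A ∈ sepSets n 1 r, 1 ∈ A → 3 ∈ A → A ∈ 𝒜) :
    (∀ A ∈ 𝒜, 1 ∈ A) ∨ (∀ A ∈ 𝒜, 3 ∈ A) := by
  have hn : 4 ≤ n := by omega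
  have hnd : ∀ X ∈ 𝒜, ∀ Y ∈ 𝒜, ¬ ∀ x ∈ X, x ∉ Y := by
    intro X hX Y hY h
    obtain ⟨x, hx⟩ := hint X hX Y hY
    rw [Finset.mem_inter] at hx
    exact h x hx.1 hx.2
  have H13 : ∀ A ∈ 𝒜, 1 ∈ A ∨ 3 ∈ A := by
    intro X hX
    by_contra hno
    push Not at hno
    obtain ⟨A, hA, hA1, hA3, hAd⟩ := exists_disjoint (p := 1) (q := 3) (by omega) hr (h𝒜 hX)
      (by omega) (by omega) hno.1 hno.2 (by omega)
      (by unfold cs; split_ifs <;> omega) (by unfold cs; split_ifs <;> omega)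
    exact hnd A (H A hA hA1 hA3) X hX hAd
  by_contra hno
  push Not at hno
  obtain ⟨⟨B, hB, hB1⟩, ⟨A, hA, hA3⟩⟩ := hno
  have hA1 : 1 ∈ A := (H13 A hA).resolve_right hA3
  have hB3 : 3 ∈ B := (H13 B hB).resolve_left hB1
  by_cases hodd : n = 2 * r + 1
  · have mA := (mem_sep (by omega) A).1 (h𝒜 hA)
    have mB := (mem_sep (by omega) B).1 (h𝒜 hB)
    have hB2 : 2 ∉ B := fun h => mB.2.2.1 2 h hB3
    have sA := fimage_sep hn (h𝒜 hA) (fun h => hA3 h.2) (fun h => mA.2.2.1 1 hA1 h.1)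
    have sB := fimage_sep hn (h𝒜 hB) (fun h => hB1 h.1) (fun h => hB2 h.1)
    have hi : Intersecting (({A, B} : Finset (Finset ℕ)).image (fun A => A.image fmap)) := by
      apply f_int
      apply hint.mono
      intro X hX
      simp only [Finset.mem_insert, Finset.mem_singleton] at hX
      rcases hX with rfl | rfl
      · exact hA
      · exact hB
    have hle := upper (n - 1) r (by omega) (by omega) _ (by
      intro X hX
      simp only [Finset.mem_image, Finset.mem_insert, Finset.mem_singleton] at hX
      obtain ⟨Y, rfl | rfl, rfl⟩ := hX
      · exact sA
      · exact sB) hi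
    rw [show n - 1 - r - 1 = r - 1 by omega, Nat.choose_self, Finset.card_le_one] at hle
    have heq := hle (A.image fmap) (by simp) (B.image fmap) (by simp)
    have m1 : 1 ∈ A.image fmap := Finset.mem_image.2 ⟨1, hA1, rfl⟩
    have m2 : 2 ∈ B.image fmap := Finset.mem_image.2 ⟨3, hB3, rfl⟩
    rw [heq] at m1
    exact ((mem_sep (by omega) _).1 sB).2.2.1 1 m1 m2
  · have hBQ : B ∈ Qfam n r := Finset.mem_filter.2 ⟨h𝒜 hB, hB3, hB1⟩
    obtain ⟨hψ, hφψ⟩ := psi_P hn hBQ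
    have := connect (𝒰 := 𝒜 ∩ Pfam n r) hr (by omega) Finset.inter_subset_right (by
      intro X hX X' hX' hd
      exact Finset.mem_inter.2 ⟨closure13 hn (by omega) h𝒜 hint hcard H13
        (Finset.mem_inter.1 hX).1 hX' hd, hX'⟩)
      ⟨A, Finset.mem_inter.2 ⟨hA, Finset.mem_filter.2 ⟨h𝒜 hA, hA1, hA3⟩⟩⟩ (psi B) hψ
    have hd := phi_disj hn hψ
    rw [hφψ] at hd
    exact hnd _ hB _ (Finset.mem_inter.1 this).1 hd

/-- cyclic predecessor -/
def cp (n x : ℕ) : ℕ := if x = 1 then n else x - 1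

lemma cs_cp {n x : ℕ} (hx : 1 ≤ x ∧ x ≤ n) : cs n (cp n x) = x := by
  unfold cs cp
  split_ifs <;> omega

lemma cp_cs {n x : ℕ} (hx : 1 ≤ x ∧ x ≤ n) : cp n (cs n x) = x := by
  unfold cs cp
  split_ifs <;> omega

lemma cp_mem {n a : ℕ} (ha : 1 ≤ a ∧ a ≤ n) : 1 ≤ cp n a ∧ cp n a ≤ n := by
  unfold cp
  split_ifs <;> omega

lemma cs_image_sep {n r : ℕ} (hn : 2 ≤ n) {A : Finset ℕ} (hA : A ∈ sepSets n 1 r) :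
    A.image (cs n) ∈ sepSets n 1 r := by
  obtain ⟨h1, h2, h3⟩ := (mem_sep' hn A).1 hA
  rw [mem_sep' hn]
  refine ⟨?_, ?_, ?_⟩
  · intro a ha
    obtain ⟨b, hb, rfl⟩ := Finset.mem_image.1 ha
    exact cs_mem (h1 b hb)
  · rw [Finset.card_image_of_injOn, h2]
    intro a ha b hb h
    exact cs_inj (h1 a ha) (h1 b hb) h
  · intro a ha hb
    obtain ⟨b, hb, rfl⟩ := Finset.mem_image.1 ha
    obtain ⟨c, hc, h⟩ := Finset.mem_image.1 hb
    have := cs_inj (h1 c hc) (cs_mem (h1 b (by assumption))) h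
    subst this
    exact h3 b (by assumption) hc

lemma cp_image_sep {n r : ℕ} (hn : 2 ≤ n) {A : Finset ℕ} (hA : A ∈ sepSets n 1 r) :
    A.image (cp n) ∈ sepSets n 1 r ∧ (A.image (cp n)).image (cs n) = A := by
  obtain ⟨h1, h2, h3⟩ := (mem_sep' hn A).1 hA
  refine ⟨?_, ?_⟩
  · rw [mem_sep' hn]
    refine ⟨?_, ?_, ?_⟩
    · intro a ha
      obtain ⟨b, hb, rfl⟩ := Finset.mem_image.1 ha
      exact cp_mem (h1 b hb)
    · rw [Finset.card_image_of_injOn, h2]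
      intro a ha b hb h
      rw [← cs_cp (h1 a ha), h, cs_cp (h1 b hb)]
    · intro a ha hb
      obtain ⟨b, hb', rfl⟩ := Finset.mem_image.1 ha
      rw [cs_cp (h1 b hb')] at hb
      obtain ⟨c, hc, rfl⟩ := Finset.mem_image.1 hb
      apply h3 _ hb'
      rwa [cs_cp (h1 c hc)]
  · rw [Finset.image_image]
    conv_rhs => rw [← Finset.image_id (s := A)]
    apply Finset.image_congr
    intro x hx
    exact cs_cp (h1 x hx)

lemma cs_image_cp {n r : ℕ} (hn : 2 ≤ n) {A : Finset ℕ} (hA : A ∈ sepSets n 1 r) :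
    (A.image (cs n)).image (cp n) = A := by
  obtain ⟨h1, h2, h3⟩ := (mem_sep' hn A).1 hA
  rw [Finset.image_image]
  conv_rhs => rw [← Finset.image_id (s := A)]
  apply Finset.image_congr
  intro x hx
  exact cp_cs (h1 x hx)

lemma star2n {n r : ℕ} (hr : 2 ≤ r) (hnr : 2 * r < n) (hne : n ≠ 2 * r + 2)
    {𝒜 : Finset (Finset ℕ)} (h𝒜 : 𝒜 ⊆ sepSets n 1 r) (hint : Intersecting 𝒜)
    (hcard : 𝒜.card = (n - r - 1).choose (r - 1))
    (H : ∀ A ∈ sepSets n 1 r, 2 ∈ A → n ∈ A → A ∈ 𝒜) :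
    (∀ A ∈ 𝒜, n ∈ A) ∨ (∀ A ∈ 𝒜, 2 ∈ A) := by
  have hn : 2 ≤ n := by omega
  have back : ∀ A ∈ 𝒜, ∀ y, 1 ≤ y ∧ y ≤ n → cs n y ∈ A.image (cs n) → y ∈ A := by
    intro A hA y hy h
    obtain ⟨x, hx, hxy⟩ := Finset.mem_image.1 h
    have h1 := ((mem_sep' hn A).1 (h𝒜 hA)).1
    rwa [← cs_inj (h1 x hx) hy hxy]
  have c1 : cs n n = 1 := by simp [cs]
  have c2 : cs n 2 = 3 := by unfold cs; rw [if_neg (by omega)]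
  have := star13 (𝒜 := 𝒜.image (fun A => A.image (cs n))) hr hnr hne ?_ ?_ ?_ ?_
  · rcases this with h | h
    · left
      intro A hA
      exact back A hA n (by omega) (by rw [c1]; exact h _ (Finset.mem_image_of_mem _ hA))
    · right
      intro A hA
      exact back A hA 2 (by omega) (by rw [c2]; exact h _ (Finset.mem_image_of_mem _ hA))
  · intro X hX
    obtain ⟨A, hA, rfl⟩ := Finset.mem_image.1 hX
    exact cs_image_sep hn (h𝒜 hA)
  · intro X hX Y hY
    obtain ⟨A, hA, rfl⟩ := Finset.mem_image.1 hX
    obtain ⟨B, hB, rfl⟩ := Finset.mem_image.1 hY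
    obtain ⟨x, hx⟩ := hint A hA B hB
    rw [Finset.mem_inter] at hx
    exact ⟨cs n x, Finset.mem_inter.2
      ⟨Finset.mem_image_of_mem _ hx.1, Finset.mem_image_of_mem _ hx.2⟩⟩
  · rw [Finset.card_image_of_injOn, hcard]
    intro A hA B hB h
    rw [← cs_image_cp hn (h𝒜 hA), ← cs_image_cp hn (h𝒜 hB)]
    simp only at h
    rw [h]
  · intro A hA h1 h3
    obtain ⟨s1, s2⟩ := cp_image_sep hn hA
    refine Finset.mem_image.2 ⟨_, H _ s1 ?_ ?_, s2⟩
    · exact Finset.mem_image.2 ⟨3, h3, by simp [cp]⟩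
    · exact Finset.mem_image.2 ⟨1, h1, by simp [cp]⟩

lemma finish {n r i : ℕ} (hn : 2 ≤ n) (hr : 1 ≤ r)
    {𝒜 : Finset (Finset ℕ)} (h𝒜 : 𝒜 ⊆ sepSets n 1 r)
    (hcard : 𝒜.card = (n - r - 1).choose (r - 1)) (H : ∀ A ∈ 𝒜, i ∈ A) :
    𝒜 = (sepSets n 1 r).filter fun A => i ∈ A := by
  apply Finset.eq_of_subset_of_card_le
  · intro A hA
    exact Finset.mem_filter.2 ⟨h𝒜 hA, H A hA⟩
  · rw [hcard]
    exact upper n r hr hn _ (Finset.filter_subset _ _) (star_int n r i)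

lemma finish_one {n r : ℕ} (hn : 2 ≤ n) (hr : 1 ≤ r)
    {𝒜 : Finset (Finset ℕ)} (h𝒜 : 𝒜 ⊆ sepSets n 1 r)
    (hcard : 𝒜.card = (n - r - 1).choose (r - 1)) (h1 : (n - r - 1).choose (r - 1) = 1) :
    ∃ i ∈ Finset.Icc 1 n, 𝒜 = (sepSets n 1 r).filter fun A => i ∈ A := by
  obtain ⟨A, hA⟩ := Finset.card_eq_one.1 (hcard.trans h1)
  have hA' : A ∈ 𝒜 := by rw [hA]; simp
  obtain ⟨m1, m2, -⟩ := (mem_sep hn A).1 (h𝒜 hA')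
  have : A.Nonempty := by rw [← Finset.card_pos]; omega
  obtain ⟨i, hi⟩ := this
  refine ⟨i, Finset.mem_Icc.2 (m1 i hi), finish hn hr h𝒜 hcard ?_⟩
  intro B hB
  rw [hA, Finset.mem_singleton] at hB
  rwa [hB]

lemma star_pull {n r c : ℕ} (hn : 4 ≤ n) {𝒜 : Finset (Finset ℕ)} (h𝒜 : 𝒜 ⊆ sepSets n 1 r)
    (hG : (Kfam n 𝒜).image gset = (sepSets (n - 2) 1 (r - 1)).filter fun A => c ∈ A)
    (hc : 1 ≤ c) {A : Finset ℕ} (hA : A ∈ sepSets n 1 r) (h12 : 1 ∈ A ∨ 2 ∈ A)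
    (hcA : c + 2 ∈ A) : A ∈ 𝒜 := by
  obtain ⟨h1, h2, h3, h4⟩ := (mem_sep (by omega) A).1 hA
  have h0 : ∀ a ∈ A, 1 ≤ a := fun a ha => (h1 a ha).1
  have hg : gset A ∈ (Kfam n 𝒜).image gset := by
    rw [hG, Finset.mem_filter]
    exact ⟨gset_sep hn hA h12, (mem_gset h0 c).2 ⟨hc, hcA⟩⟩
  obtain ⟨A', hK, he⟩ := Finset.mem_image.1 hg
  have hA'𝒜 := Finset.mem_of_mem_filter _ hK
  obtain ⟨h1', h2', h3', h4'⟩ := (mem_sep (by omega) A').1 (h𝒜 hA'𝒜)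
  have h0' : ∀ a ∈ A', 1 ≤ a := fun a ha => (h1' a ha).1
  have key : ∀ x, 3 ≤ x → (x ∈ A ↔ x ∈ A') := by
    intro x hx
    have e1 := mem_gset h0 (x - 2)
    have e2 := mem_gset h0' (x - 2)
    rw [show x - 2 + 2 = x by omega] at e1 e2
    rw [← he, e2] at e1
    grind
  have same : ((1 ∈ A ∧ 1 ∈ A') ∨ (2 ∈ A ∧ 2 ∈ A')) → A ∈ 𝒜 := by
    intro h
    rw [K_inj hn hA (h𝒜 hA'𝒜) h he.symm]
    exact hA'𝒜
  unfold Kfam at hK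
  rw [Finset.mem_filter] at hK
  rcases h12 with m | m <;> rcases hK.2 with ⟨m', k⟩ | ⟨m', k⟩ | ⟨m', k⟩
  · exact same (Or.inl ⟨m, m'⟩)
  · exact (h4 m ((key n (by omega)).2 k)).elim
  · exact same (Or.inl ⟨m, m'⟩)
  · exact (h3 2 m ((key 3 (by omega)).2 k)).elim
  · exact same (Or.inr ⟨m, m'⟩)
  · convert k using 1
    ext x
    have c1 := h3 1
    simp only [Finset.mem_insert, Finset.mem_erase]
    by_cases hx : 3 ≤ x
    · rw [key x hx]
      constructor
      · intro h; exact Or.inr ⟨by omega, h⟩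
      · rintro (h | h)
        · omega
        · exact h.2
    · have c3 := h0 0
      have c4 := h0' 0
      have c5 := h3' 1
      have : x = 0 ∨ x = 1 ∨ x = 2 := by omega
      rcases this with rfl | rfl | rfl <;> grind

lemma main_aux (r : ℕ) (hr : 1 ≤ r) : ∀ n, 2 * r ≤ n → n ≠ 2 * r + 2 →
    ∀ 𝒜 : Finset (Finset ℕ), 𝒜 ⊆ sepSets n 1 r → Intersecting 𝒜 →
    𝒜.card = (n - r - 1).choose (r - 1) →
    ∃ i ∈ Finset.Icc 1 n, 𝒜 = (sepSets n 1 r).filter fun A => i ∈ A := by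
  induction r, hr using Nat.le_induction with
  | base =>
    intro n hn _ 𝒜 h𝒜 _ hcard
    exact finish_one (by omega) (le_refl _) h𝒜 hcard (by simp)
  | succ s hs ih =>
    intro n hn hne 𝒜 h𝒜 hint hcard
    by_cases he : n = 2 * (s + 1)
    · refine finish_one (by omega) (by omega) h𝒜 hcard ?_
      rw [show n - (s + 1) - 1 = s + 1 - 1 by omega, Nat.choose_self]
    have hn4 : 4 ≤ n := by omega
    have hsplit := card_split hn4 h𝒜
    have b1 := upper (n - 1) (s + 1) (by omega) (by omega) _ (L_sub hn4 h𝒜)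
      (f_int (hint.mono Finset.sdiff_subset))
    have b2 := upper (n - 2) (s + 1 - 1) (by omega) (by omega) _ (K_sub hn4 h𝒜)
      (K_int hn4 h𝒜 hint)
    have hpas : (n - (s + 1) - 1).choose (s + 1 - 1) = (n - 1 - (s + 1) - 1).choose (s + 1 - 1) +
        (n - 2 - (s + 1 - 1) - 1).choose (s + 1 - 1 - 1) := by
      obtain ⟨u, rfl⟩ : ∃ u, s = u + 1 := ⟨s - 1, by omega⟩
      obtain ⟨m, rfl⟩ : ∃ m, n = m + u + 4 := ⟨n - u - 4, by omega⟩
      rw [show m + u + 4 - (u + 1 + 1) - 1 = m + 1 by omega,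
        show m + u + 4 - 1 - (u + 1 + 1) - 1 = m by omega,
        show m + u + 4 - 2 - (u + 1 + 1 - 1) - 1 = m by omega,
        show u + 1 + 1 - 1 = u + 1 by omega, show u + 1 - 1 = u by omega,
        Nat.choose_succ_succ']
      omega
    have hKs := K_sub hn4 h𝒜
    have hKi := K_int hn4 h𝒜 hint
    rw [show s + 1 - 1 = s by omega] at hKs
    obtain ⟨c, hc, hG⟩ := ih (n - 2) (by omega) (by omega) _ hKs hKi (by
      rw [show s + 1 - 1 = s by omega] at *
      omega)
    rw [Finset.mem_Icc] at hc
    have pull : ∀ A ∈ sepSets n 1 (s + 1), (1 ∈ A ∨ 2 ∈ A) → c + 2 ∈ A → A ∈ 𝒜 :=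
      fun A hA h12 hcA => star_pull hn4 h𝒜 hG hc.1 hA h12 hcA
    have fin : ∀ i, 1 ≤ i ∧ i ≤ n → (∀ A ∈ 𝒜, i ∈ A) →
        ∃ i ∈ Finset.Icc 1 n, 𝒜 = (sepSets n 1 (s + 1)).filter fun A => i ∈ A :=
      fun i hi h => ⟨i, Finset.mem_Icc.2 hi, finish (by omega) (by omega) h𝒜 hcard h⟩
    by_cases c1 : c = 1
    · subst c1
      rcases star13 (by omega) (by omega) hne h𝒜 hint hcard
        (fun A hA m1 m3 => pull A hA (Or.inl m1) m3) with h | h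
      · exact fin 1 (by omega) h
      · exact fin 3 (by omega) h
    by_cases c2 : c = n - 2
    · rcases star2n (by omega) (by omega) hne h𝒜 hint hcard
        (fun A hA m1 m3 => pull A hA (Or.inr m1) (by rwa [show c + 2 = n by omega])) with h | h
      · exact fin n (by omega) h
      · exact fin 2 (by omega) h
    refine fin (c + 2) (by omega) ?_
    intro X hX
    by_contra hno
    obtain ⟨p, hp, hpX⟩ : ∃ p, (p = 1 ∨ p = 2) ∧ p ∉ X := by
      by_cases h : 1 ∈ X
      · exact ⟨2, Or.inr rfl, ((mem_sep (by omega) X).1 (h𝒜 hX)).2.2.1 1 h⟩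
      · exact ⟨1, Or.inl rfl, h⟩
    obtain ⟨A, hA, hA1, hA2, hAd⟩ := exists_disjoint (p := p) (q := c + 2) (by omega) (by omega)
      (h𝒜 hX) (by omega) (by omega) hpX hno (by omega)
      (by unfold cs; split_ifs <;> omega) (by unfold cs; split_ifs <;> omega)
    have hA𝒜 : A ∈ 𝒜 := pull A hA (by rcases hp with rfl | rfl <;> simp [hA1]) hA2
    obtain ⟨x, hx⟩ := hint A hA𝒜 X hX
    rw [Finset.mem_inter] at hx
    exact hAd x hx.1 hx.2

theorem stmt1 (n r : ℕ) (hr : 1 ≤ r) (hn : 2 * r ≤ n) (hne : n ≠ 2 * r + 2)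
    (𝒜 : Finset (Finset ℕ)) (h𝒜 : 𝒜 ⊆ sepSets n 1 r) (hint : Intersecting 𝒜)
    (hcard : 𝒜.card = (n - r - 1).choose (r - 1)) :
    ∃ i ∈ Finset.Icc 1 n, 𝒜 = (sepSets n 1 r).filter fun A => i ∈ A := by
  exact main_aux r hr n hn hne 𝒜 h𝒜 hint hcard
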